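/- arXiv:2110.00088 — 11 statements merged into one kernel-verified Lean document; each statement's English description precedes it below -/
import Mathlib

section
/- Let Ξ ⊆ ℝ^d be a nonempty compact set, let Z : Ξ → ℝ be continuous, let δ ∈ (0,1), and let 𝒫 be a nonempty convex set of Borel probability measures on Ξ. Then the worst-case conditional value-at-risk satisfies the minimax interchange: sup_{P ∈ 𝒫} inf_{θ ∈ ℝ} { θ + δ^{-1} E_P[max(Z(ξ) − θ, 0)] } = inf_{θ ∈ ℝ} sup_{P ∈ 𝒫} { θ + δ^{-1} E_P[max(Z(ξ) − θ, 0)] }. -/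
open Matrix MeasureTheory
open scoped ENNReal

/-- Minimax for a convex family of convex functions of one real variable. -/
theorem aux_minimax (Y : Set (ℝ → ℝ)) (hne : Y.Nonempty) (hY : Convex ℝ Y) (m M : ℝ) (hmM : m ≤ M)
    (U : ℝ → ℝ) (hconv : ∀ y ∈ Y, ConvexOn ℝ Set.univ y)
    (hlow : ∀ y ∈ Y, ∀ t, t ≤ y t) (hup : ∀ y ∈ Y, ∀ t, y t ≤ U t)
    (hcl : ∀ y ∈ Y, ∀ t, y (max m (min t M)) ≤ y t) :
    sSup ((fun y : ℝ → ℝ => ⨅ t : ℝ, y t) '' Y) = ⨅ t : ℝ, sSup ((fun y : ℝ → ℝ => y t) '' Y) := by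
  have hc : ∀ t, max m (min t M) ∈ Set.Icc m M := fun t =>
    ⟨le_max_left _ _, max_le hmM (min_le_right _ _)⟩
  have hm : ∀ y ∈ Y, ∀ t, m ≤ y t := fun y hy t =>
    (hc t).1.trans ((hlow y hy _).trans (hcl y hy t))
  have hbdd : ∀ t, BddAbove ((fun y : ℝ → ℝ => y t) '' Y) := by
    intro t
    refine ⟨U t, ?_⟩
    rintro _ ⟨y, hy, rfl⟩
    exact hup y hy t
  have hbelow : ∀ y ∈ Y, BddBelow (Set.range y) := by
    intro y hy
    refine ⟨m, ?_⟩
    rintro _ ⟨t, rfl⟩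
    exact hm y hy t
  obtain ⟨y0, hy0⟩ := hne
  have hle : ∀ t, ∀ y ∈ Y, y t ≤ sSup ((fun y : ℝ → ℝ => y t) '' Y) :=
    fun t y hy => le_csSup (hbdd t) ⟨y, hy, rfl⟩
  have hbelow2 : BddBelow (Set.range fun t : ℝ => sSup ((fun y : ℝ → ℝ => y t) '' Y)) := by
    refine ⟨m, ?_⟩
    rintro _ ⟨t, rfl⟩
    exact (hm y0 hy0 t).trans (hle t y0 hy0)
  symm
  refine Sion.minimax (X := Set.Icc m M) (Y := Y) (f := fun t y => y t)
    (Set.nonempty_Icc.2 hmM) isCompact_Icc ?_ ?_ hY ?_ ?_ (convex_Icc m M)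
    (fun t => sSup ((fun y : ℝ → ℝ => y t) '' Y)) ?_ _ ?_
    (fun y => ⨅ t, y t) ?_ _ ?_
  · intro y hy
    exact (((hconv y hy).continuousOn isOpen_univ).mono (Set.subset_univ _)).lowerSemicontinuousOn
  · intro y hy
    exact ((hconv y hy).subset (Set.subset_univ _) (convex_Icc m M)).quasiconvexOn
  · intro t _
    exact (continuous_apply t).continuousOn.upperSemicontinuousOn
  · intro t _
    exact ((LinearMap.proj (R := ℝ) (φ := fun _ : ℝ => ℝ) t).concaveOn hY).quasiconcaveOn
  · intro t _
    exact isLUB_csSup ⟨_, y0, hy0, rfl⟩ (hbdd t)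
  · constructor
    · rintro _ ⟨t, _, rfl⟩
      exact ciInf_le hbelow2 t
    · intro b hb
      refine le_ciInf fun t => ?_
      refine (hb ⟨_, hc t, rfl⟩).trans ?_
      refine csSup_le ⟨_, y0, hy0, rfl⟩ ?_
      rintro _ ⟨y, hy, rfl⟩
      exact (hcl y hy t).trans (hle t y hy)
  · intro y hy
    constructor
    · rintro _ ⟨t, _, rfl⟩
      exact ciInf_le (hbelow y hy) t
    · intro b hb
      exact le_ciInf fun t => (hb ⟨_, hc t, rfl⟩).trans (hcl y hy t)
  · refine isLUB_csSup ⟨_, y0, hy0, rfl⟩ ⟨U 0, ?_⟩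
    rintro _ ⟨y, hy, rfl⟩
    exact (ciInf_le (hbelow y hy) 0).trans (hup y hy 0)

/-- **Minimax interchange for the worst-case CVaR.**
For a nonempty compact set `Ξ ⊆ ℝ^d`, a continuous `Z : Ξ → ℝ`, `δ ∈ (0,1)` and a nonempty
convex set `𝓟` of Borel probability measures on `Ξ`,
`sup_{P ∈ 𝓟} inf_{θ ∈ ℝ} { θ + δ⁻¹ E_P[(Z − θ)⁺] } = inf_{θ ∈ ℝ} sup_{P ∈ 𝓟} { θ + δ⁻¹ E_P[(Z − θ)⁺] }`. -/
theorem worst_case_cvar_minimax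
    (d : ℕ) (Ξ : Set (Fin d → ℝ)) (hΞne : Ξ.Nonempty) (hΞcomp : IsCompact Ξ)
    (Z : (Fin d → ℝ) → ℝ) (hZ : ContinuousOn Z Ξ)
    (δ : ℝ) (hδ : δ ∈ Set.Ioo (0 : ℝ) 1)
    (𝓟 : Set (Measure (Fin d → ℝ))) (h𝓟ne : 𝓟.Nonempty)
    (h𝓟prob : ∀ P ∈ 𝓟, IsProbabilityMeasure P)
    (h𝓟supp : ∀ P ∈ 𝓟, P Ξᶜ = 0)
    (h𝓟conv : ∀ P ∈ 𝓟, ∀ Q ∈ 𝓟, ∀ a b : ℝ≥0∞, a + b = 1 → a • P + b • Q ∈ 𝓟) :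
    sSup ((fun P : Measure (Fin d → ℝ) =>
        ⨅ θ : ℝ, θ + δ⁻¹ * ∫ ξ, max (Z ξ - θ) 0 ∂P) '' 𝓟)
      = ⨅ θ : ℝ, sSup ((fun P : Measure (Fin d → ℝ) =>
          θ + δ⁻¹ * ∫ ξ, max (Z ξ - θ) 0 ∂P) '' 𝓟) := by
  obtain ⟨hδ0, hδ1⟩ := hδ
  have hinv : 1 ≤ δ⁻¹ := (one_le_inv₀ hδ0).2 hδ1.le
  have hinv0 : 0 ≤ δ⁻¹ := by linarith
  obtain ⟨xm, hxm, hmin⟩ := hΞcomp.exists_isMinOn hΞne hZ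
  obtain ⟨xM, hxM, hmax⟩ := hΞcomp.exists_isMaxOn hΞne hZ
  have hae : ∀ P ∈ 𝓟, ∀ᵐ ξ ∂P, ξ ∈ Ξ := fun P hP => h𝓟supp P hP
  have hint : ∀ P ∈ 𝓟, ∀ θ : ℝ, Integrable (fun ξ => max (Z ξ - θ) 0) P := by
    intro P hP θ
    have := h𝓟prob P hP
    rw [← Measure.restrict_eq_self_of_ae_mem (hae P hP)]
    exact ContinuousOn.integrableOn_compact hΞcomp ((hZ.sub continuousOn_const).sup continuousOn_const)
  have hint2 : ∀ P ∈ 𝓟, ∀ θ : ℝ, Integrable (fun ξ => θ + δ⁻¹ * max (Z ξ - θ) 0) P := by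
    intro P hP θ
    have := h𝓟prob P hP
    exact (integrable_const θ).add ((hint P hP θ).const_mul _)
  have heq : ∀ P ∈ 𝓟, ∀ θ : ℝ, θ + δ⁻¹ * ∫ ξ, max (Z ξ - θ) 0 ∂P
      = ∫ ξ, (θ + δ⁻¹ * max (Z ξ - θ) 0) ∂P := by
    intro P hP θ
    have := h𝓟prob P hP
    rw [integral_add (integrable_const θ) ((hint P hP θ).const_mul _), integral_const_mul]
    simp
  let F : Measure (Fin d → ℝ) → ℝ → ℝ := fun P θ => θ + δ⁻¹ * ∫ ξ, max (Z ξ - θ) 0 ∂P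
  have key := aux_minimax (F '' 𝓟) (h𝓟ne.image F) ?_ (Z xm) (Z xM) (hmin hxM)
    (fun t => t + δ⁻¹ * max (Z xM - t) 0) ?_ ?_ ?_ ?_
  · simpa only [Set.image_image, F] using key
  · rintro _ ⟨P, hP, rfl⟩ _ ⟨Q, hQ, rfl⟩ a b ha hb hab
    refine ⟨ENNReal.ofReal a • P + ENNReal.ofReal b • Q, h𝓟conv P hP Q hQ _ _ ?_, ?_⟩
    · rw [← ENNReal.ofReal_add ha hb, hab, ENNReal.ofReal_one]
    · funext θ
      simp only [F, Pi.add_apply, Pi.smul_apply, smul_eq_mul]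
      rw [integral_add_measure ((hint P hP θ).smul_measure ENNReal.ofReal_ne_top)
        ((hint Q hQ θ).smul_measure ENNReal.ofReal_ne_top), integral_smul_measure,
        integral_smul_measure, ENNReal.toReal_ofReal ha, ENNReal.toReal_ofReal hb]
      simp only [smul_eq_mul]
      linear_combination (-θ) * hab
  · rintro _ ⟨P, hP, rfl⟩
    refine ⟨convex_univ, ?_⟩
    intro s _ t _ a b ha hb hab
    simp only [F, smul_eq_mul]
    rw [heq P hP, heq P hP, heq P hP, ← integral_const_mul, ← integral_const_mul,
      ← integral_add ((hint2 P hP s).const_mul _) ((hint2 P hP t).const_mul _)]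
    refine integral_mono (hint2 P hP _)
      (((hint2 P hP s).const_mul _).add ((hint2 P hP t).const_mul _)) fun ξ => ?_
    have h : max (Z ξ - (a * s + b * t)) 0 ≤ a * max (Z ξ - s) 0 + b * max (Z ξ - t) 0 := by
      have h1 := mul_le_mul_of_nonneg_left (le_max_left (Z ξ - s) 0) ha
      have h2 := mul_le_mul_of_nonneg_left (le_max_left (Z ξ - t) 0) hb
      have h3 := mul_nonneg ha (le_max_right (Z ξ - s) 0)
      have h4 := mul_nonneg hb (le_max_right (Z ξ - t) 0)
      refine max_le ?_ (by linarith)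
      have : Z ξ = a * Z ξ + b * Z ξ := by rw [← add_mul, hab, one_mul]
      linarith
    have := mul_le_mul_of_nonneg_left h hinv0
    simp only
    linarith
  · rintro _ ⟨P, hP, rfl⟩ t
    have : 0 ≤ ∫ ξ, max (Z ξ - t) 0 ∂P := integral_nonneg fun ξ => le_max_right _ _
    have := mul_nonneg hinv0 this
    simp only [F]
    linarith
  · rintro _ ⟨P, hP, rfl⟩ t
    have := h𝓟prob P hP
    have h : ∫ ξ, max (Z ξ - t) 0 ∂P ≤ ∫ _ξ, max (Z xM - t) 0 ∂P := by
      refine integral_mono_ae (hint P hP t) (integrable_const _) ?_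
      filter_upwards [hae P hP] with ξ hξ
      exact max_le_max_right 0 (sub_le_sub_right (hmax hξ) t)
    rw [integral_const, probReal_univ, one_smul] at h
    simp only [F]
    gcongr
  · rintro _ ⟨P, hP, rfl⟩ t
    simp only [F]
    rw [heq P hP, heq P hP]
    refine integral_mono_ae (hint2 P hP _) (hint2 P hP _) ?_
    filter_upwards [hae P hP] with ξ hξ
    have h1 : Z xm ≤ Z ξ := hmin hξ
    have h2 : Z ξ ≤ Z xM := hmax hξ
    rcases le_total t (Z xm) with h | h
    · rw [min_eq_left (by linarith), max_eq_left h, max_eq_left (by linarith),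
        max_eq_left (by linarith)]
      nlinarith
    rcases le_total t (Z xM) with hh | hh
    · rw [min_eq_left hh, max_eq_right h]
    · rw [min_eq_right hh, max_eq_right (by linarith), max_eq_right (a := Z ξ - Z xM) (by linarith),
        max_eq_right (by linarith)]
      linarith
end

section
/- Fix p̂ ∈ ℝ^K with p̂ ≥ 0 and Σ_{k=1}^K p̂_k = 1, and fix γ ≥ 0. For every p ∈ ℝ^K with p ≥ 0 and Σ_{k=1}^K p_k = 1, the following are equivalent: (i) for every k with p_k = 0 one has p̂_k = 0, and Σ_{k : p_k > 0} (p_k − p̂_k)²/p_k ≤ γ; (ii) there exists q ∈ ℝ^K with q ≥ 0, Σ_{k=1}^K q_k ≤ γ, and sqrt((p_k − p̂_k)² + p_k²/4 + q_k²) ≤ p_k/2 + q_k for every k ∈ {1,…,K}. -/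
/-- **Second-order-cone representation of the χ² uncertainty set.**
For a probability vector `p̂` and `γ ≥ 0`, a probability vector `p` satisfies the χ²-distance
condition `Σ_{k : p_k > 0} (p_k − p̂_k)²/p_k ≤ γ` (with `p̂_k = 0` whenever `p_k = 0`) if and
only if there exists `q ≥ 0` with `Σ_k q_k ≤ γ` and
`sqrt((p_k − p̂_k)² + p_k²/4 + q_k²) ≤ p_k/2 + q_k` for every `k`. -/
theorem chi_square_set_soc_representation
    (K : ℕ) (phat : Fin K → ℝ) (hphat : ∀ k, 0 ≤ phat k) (hphatsum : ∑ k, phat k = 1)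
    (γ : ℝ) (hγ : 0 ≤ γ)
    (p : Fin K → ℝ) (hp : ∀ k, 0 ≤ p k) (hpsum : ∑ k, p k = 1) :
    ((∀ k, p k = 0 → phat k = 0) ∧
        ∑ k ∈ Finset.univ.filter (fun k => 0 < p k), (p k - phat k) ^ 2 / p k ≤ γ)
      ↔ ∃ q : Fin K → ℝ, (∀ k, 0 ≤ q k) ∧ (∑ k, q k ≤ γ) ∧
          ∀ k, Real.sqrt ((p k - phat k) ^ 2 + (p k) ^ 2 / 4 + (q k) ^ 2)
            ≤ p k / 2 + q k := by
  have hsum : ∑ k ∈ Finset.univ.filter (fun k => 0 < p k), (p k - phat k) ^ 2 / p k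
      = ∑ k, (p k - phat k) ^ 2 / p k := by
    apply Finset.sum_subset (Finset.filter_subset _ _)
    intro k _ hk
    have h0 : p k = 0 := by
      by_contra hne
      exact hk (by simpa using lt_of_le_of_ne (hp k) (Ne.symm hne))
    rw [h0, div_zero]
  rw [hsum]
  constructor
  · rintro ⟨h0, hle⟩
    refine ⟨fun k => (p k - phat k) ^ 2 / p k, fun k => div_nonneg (sq_nonneg _) (hp k), hle, ?_⟩
    intro k
    have hq : 0 ≤ (p k - phat k) ^ 2 / p k := div_nonneg (sq_nonneg _) (hp k)
    have hmul : (p k - phat k) ^ 2 / p k * p k = (p k - phat k) ^ 2 := by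
      by_cases h : p k = 0
      · simp [h, h0 k h]
      · exact div_mul_cancel₀ _ h
    have hpk := hp k
    apply Real.sqrt_le_iff.mpr
    refine ⟨by positivity, ?_⟩
    dsimp only
    nlinarith [hmul]
  · rintro ⟨q, hq, hle, hs⟩
    have key : ∀ k, (p k - phat k) ^ 2 ≤ q k * p k := by
      intro k
      have h := (Real.sqrt_le_iff.mp (hs k)).2
      nlinarith [h]
    constructor
    · intro k hk
      have h := key k
      rw [hk] at h
      have h2 : phat k ^ 2 ≤ 0 := by nlinarith [h]
      exact pow_eq_zero_iff (two_ne_zero) |>.mp (le_antisymm h2 (sq_nonneg _))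
    · refine le_trans (Finset.sum_le_sum fun k _ => ?_) hle
      exact div_le_of_le_mul₀ (hp k) (hq k) (key k)
end

section
/- Let K ⊆ ℝ^n be a closed convex cone whose unit slice Ξ = { ξ ∈ K : ξ_n = 1 } is nonempty and compact, and let C be a symmetric n×n real matrix. Then sup_{ξ ∈ Ξ} ξᵀCξ = sup { tr(CX) : X ∈ C*(K) and X_{nn} = 1 }, where both suprema are finite. -/
open Matrix

/-- `X` belongs to the (generalized) completely positive cone `C*(K)`:
`X = Σ_i x_i x_iᵀ` with each `x_i ∈ K`. -/
def IsCompletelyPositive {n : ℕ} (K : Set (Fin n → ℝ))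
    (X : Matrix (Fin n) (Fin n) ℝ) : Prop :=
  ∃ (m : ℕ) (x : Fin m → (Fin n → ℝ)), (∀ i, x i ∈ K) ∧
    X = ∑ i, vecMulVec (x i) (x i)

/-- **Equivalence of a nonconvex quadratic program over the unit slice of a cone and its
completely positive reformulation** (value statement). If `K ⊆ ℝ^{n+1}` is a closed convex
cone whose unit slice `Ξ = {ξ ∈ K : ξ_last = 1}` is nonempty and compact, and `C` is
symmetric, then `sup_{ξ ∈ Ξ} ξᵀCξ = sup { tr(CX) : X ∈ C*(K), X_{nn} = 1 }`,
and both suprema are finite. -/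
theorem quadratic_program_cpp_equivalence
    (n : ℕ) (K : Set (Fin (n + 1) → ℝ))
    (hKclosed : IsClosed K) (hKconv : Convex ℝ K)
    (hKcone : ∀ c : ℝ, 0 ≤ c → ∀ v ∈ K, c • v ∈ K)
    (hΞne : {ξ ∈ K | ξ (Fin.last n) = 1}.Nonempty)
    (hΞcomp : IsCompact {ξ ∈ K | ξ (Fin.last n) = 1})
    (C : Matrix (Fin (n + 1)) (Fin (n + 1)) ℝ) (hC : C.IsSymm) :
    sSup ((fun ξ => ξ ⬝ᵥ C *ᵥ ξ) '' {ξ ∈ K | ξ (Fin.last n) = 1})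
        = sSup {r : ℝ | ∃ X, IsCompletelyPositive K X ∧
            X (Fin.last n) (Fin.last n) = 1 ∧ r = (C * X).trace} ∧
      BddAbove ((fun ξ => ξ ⬝ᵥ C *ᵥ ξ) '' {ξ ∈ K | ξ (Fin.last n) = 1}) ∧
      BddAbove {r : ℝ | ∃ X, IsCompletelyPositive K X ∧
          X (Fin.last n) (Fin.last n) = 1 ∧ r = (C * X).trace} := by
  have hq : ∀ (c : ℝ) (v : Fin (n + 1) → ℝ),
      (c • v) ⬝ᵥ C *ᵥ (c • v) = c ^ 2 * (v ⬝ᵥ C *ᵥ v) := by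
    intro c v
    rw [mulVec_smul, smul_dotProduct, dotProduct_smul, smul_eq_mul, smul_eq_mul]
    ring
  have htr : ∀ v : Fin (n + 1) → ℝ, (C * vecMulVec v v).trace = v ⬝ᵥ C *ᵥ v := by
    intro v
    rw [mul_vecMulVec, trace_vecMulVec, dotProduct_comm]
  have hadd : ∀ x ∈ K, ∀ y ∈ K, x + y ∈ K := by
    intro x hx y hy
    have h := hKcone 2 (by norm_num) _
      (hKconv hx hy (a := 1 / 2) (b := 1 / 2) (by norm_num) (by norm_num) (by norm_num))
    have e : (2 : ℝ) • ((1 / 2 : ℝ) • x + (1 / 2 : ℝ) • y) = x + y := by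
      rw [smul_add, smul_smul, smul_smul]; norm_num
    rwa [e] at h
  have hb1 : BddAbove ((fun ξ => ξ ⬝ᵥ C *ᵥ ξ) '' {ξ ∈ K | ξ (Fin.last n) = 1}) := by
    apply (hΞcomp.image _).bddAbove
    fun_prop
  obtain ⟨ξ, hξK, hξ1⟩ := hΞne
  have hzero : ∀ y ∈ K, y (Fin.last n) = 0 → y = 0 := by
    intro y hy h0
    obtain ⟨R, hR⟩ := hΞcomp.isBounded.exists_norm_le
    by_contra hne
    have hpos : 0 < ‖y‖ := norm_pos_iff.mpr hne
    have hR0 : 0 ≤ R := (norm_nonneg _).trans (hR ξ ⟨hξK, hξ1⟩)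
    have ht : 0 ≤ (2 * R + 1) / ‖y‖ := by positivity
    have h := hR (ξ + ((2 * R + 1) / ‖y‖) • y)
      ⟨hadd _ hξK _ (hKcone _ ht _ hy), by simp [h0, hξ1]⟩
    have h2 := hR ξ ⟨hξK, hξ1⟩
    have h3 : ‖((2 * R + 1) / ‖y‖) • y‖ = 2 * R + 1 := by
      rw [norm_smul, Real.norm_of_nonneg ht, div_mul_cancel₀ _ hpos.ne']
    have h4 := norm_sub_le (ξ + ((2 * R + 1) / ‖y‖) • y) ξ
    rw [add_sub_cancel_left, h3] at h4
    linarith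
  set M := sSup ((fun ξ => ξ ⬝ᵥ C *ᵥ ξ) '' {ξ ∈ K | ξ (Fin.last n) = 1}) with hM
  have hle : ∀ v ∈ K, v (Fin.last n) = 1 → v ⬝ᵥ C *ᵥ v ≤ M := fun v hv h1 =>
    le_csSup hb1 ⟨v, ⟨hv, h1⟩, rfl⟩
  have key : ∀ x ∈ K, x ⬝ᵥ C *ᵥ x ≤ x (Fin.last n) ^ 2 * M := by
    intro x hx
    have fin : ∀ (c : ℝ) (v : Fin (n + 1) → ℝ), v ∈ K → v (Fin.last n) = 1 → x = c • v →
        x ⬝ᵥ C *ᵥ x ≤ x (Fin.last n) ^ 2 * M := by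
      intro c v hv h1 e
      rw [e, hq]
      simp only [Pi.smul_apply, smul_eq_mul, h1, mul_one]
      exact mul_le_mul_of_nonneg_left (hle v hv h1) (sq_nonneg c)
    rcases lt_trichotomy (x (Fin.last n)) 0 with h | h | h
    · have hc : 0 ≤ (-x (Fin.last n))⁻¹ := inv_nonneg.mpr (by linarith)
      have hy := hzero _ (hadd _ (hKcone _ hc _ hx) _ hξK) (by
        simp only [Pi.add_apply, Pi.smul_apply, smul_eq_mul, hξ1]
        rw [inv_neg, neg_mul, inv_mul_cancel₀ h.ne]
        norm_num)
      refine fin (x (Fin.last n)) ξ hξK hξ1 ?_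
      rw [← neg_eq_of_add_eq_zero_right hy, inv_neg, neg_smul, neg_neg, smul_smul,
        mul_inv_cancel₀ h.ne, one_smul]
    · exact fin 0 ξ hξK hξ1 (by rw [zero_smul]; exact hzero x hx h)
    · refine fin (x (Fin.last n)) ((x (Fin.last n))⁻¹ • x)
        (hKcone _ (inv_nonneg.mpr h.le) _ hx) ?_ ?_
      · simp [h.ne']
      · rw [smul_smul, mul_inv_cancel₀ h.ne', one_smul]
  have hub : ∀ r ∈ {r : ℝ | ∃ X, IsCompletelyPositive K X ∧
      X (Fin.last n) (Fin.last n) = 1 ∧ r = (C * X).trace}, r ≤ M := by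
    rintro r ⟨X, ⟨m, x, hx, rfl⟩, h1, rfl⟩
    rw [Matrix.mul_sum, trace_sum]
    rw [Matrix.sum_apply] at h1
    calc ∑ i, (C * vecMulVec (x i) (x i)).trace
        ≤ ∑ i, vecMulVec (x i) (x i) (Fin.last n) (Fin.last n) * M := by
          apply Finset.sum_le_sum
          intro i _
          rw [htr, vecMulVec_apply, ← pow_two]
          exact key _ (hx i)
      _ = M := by rw [← Finset.sum_mul, h1, one_mul]
  have hsub : ∀ v ∈ K, v (Fin.last n) = 1 → v ⬝ᵥ C *ᵥ v ∈ {r : ℝ | ∃ X,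
      IsCompletelyPositive K X ∧ X (Fin.last n) (Fin.last n) = 1 ∧ r = (C * X).trace} := by
    intro v hv h1
    exact ⟨vecMulVec v v, ⟨1, fun _ => v, fun _ => hv, by simp⟩,
      by simp [vecMulVec_apply, h1], (htr v).symm⟩
  have hb2 : BddAbove {r : ℝ | ∃ X, IsCompletelyPositive K X ∧
      X (Fin.last n) (Fin.last n) = 1 ∧ r = (C * X).trace} := ⟨M, hub⟩
  refine ⟨le_antisymm ?_ ?_, hb1, hb2⟩
  · rw [hM]
    refine csSup_le (Set.Nonempty.image _ ⟨ξ, hξK, hξ1⟩) ?_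
    rintro _ ⟨v, ⟨hv, h1⟩, rfl⟩
    exact le_csSup hb2 (hsub v hv h1)
  · exact csSup_le ⟨_, hsub ξ hξK hξ1⟩ hub
end

section
/- Let K ⊆ ℝ^n be a closed convex cone whose unit slice Ξ = { ξ ∈ K : ξ_n = 1 } is nonempty and compact, and let C be a symmetric n×n real matrix. If X* ∈ C*(K) satisfies X*_{nn} = 1 and tr(CX*) = sup { tr(CX) : X ∈ C*(K), X_{nn} = 1 }, then the last column of X* (which is a vector in ℝ^n whose last entry equals 1) belongs to the convex hull of the set of maximizers { ξ ∈ Ξ : ξᵀCξ = sup_{ξ' ∈ Ξ} ξ'ᵀCξ' }. -/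
open Matrix

section CppHelpers

lemma cpp_cone_add {n : ℕ} {K : Set (Fin (n + 1) → ℝ)} (hKconv : Convex ℝ K)
    (hKcone : ∀ c : ℝ, 0 ≤ c → ∀ v ∈ K, c • v ∈ K) {x y : Fin (n + 1) → ℝ}
    (hx : x ∈ K) (hy : y ∈ K) : x + y ∈ K := by
  have h := hKcone 2 (by norm_num) _
    (hKconv hx hy (a := 1/2) (b := 1/2) (by norm_num) (by norm_num) (by norm_num))
  convert h using 1
  ext i
  simp
  ring

/-- A vector of `K` with vanishing last coordinate is zero. -/
lemma cpp_zero_of_last {n : ℕ} {K : Set (Fin (n + 1) → ℝ)} (hKconv : Convex ℝ K)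
    (hKcone : ∀ c : ℝ, 0 ≤ c → ∀ v ∈ K, c • v ∈ K)
    (hcomp : IsCompact {ξ ∈ K | ξ (Fin.last n) = 1})
    {ξ₀ : Fin (n + 1) → ℝ} (h0 : ξ₀ ∈ K) (h01 : ξ₀ (Fin.last n) = 1)
    {v : Fin (n + 1) → ℝ} (hv : v ∈ K) (hv0 : v (Fin.last n) = 0) : v = 0 := by
  by_contra hne
  have hpos : 0 < ‖v‖ := norm_pos_iff.mpr hne
  obtain ⟨R, hR⟩ := hcomp.isBounded.exists_norm_le
  have hR0 := hR ξ₀ ⟨h0, h01⟩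
  have hRn : 0 ≤ R := (norm_nonneg _).trans hR0
  set t : ℝ := (2 * R + 1) / ‖v‖ with ht
  have ht0 : 0 ≤ t := by positivity
  have h1 := hR (ξ₀ + t • v) ⟨cpp_cone_add hKconv hKcone h0 (hKcone t ht0 v hv), by
    simp [h01, hv0]⟩
  have h2 : ‖t • v‖ = 2 * R + 1 := by
    rw [norm_smul, Real.norm_of_nonneg ht0, ht]
    field_simp
  have h3 : ‖t • v‖ ≤ ‖ξ₀ + t • v‖ + ‖ξ₀‖ := by
    have := norm_sub_le (ξ₀ + t • v) ξ₀
    simpa using this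
  linarith

/-- Every vector of `K` is its last coordinate times a point of the slice. -/
lemma cpp_decomp {n : ℕ} {K : Set (Fin (n + 1) → ℝ)} (hKconv : Convex ℝ K)
    (hKcone : ∀ c : ℝ, 0 ≤ c → ∀ v ∈ K, c • v ∈ K)
    (hcomp : IsCompact {ξ ∈ K | ξ (Fin.last n) = 1})
    {ξ₀ : Fin (n + 1) → ℝ} (h0 : ξ₀ ∈ K) (h01 : ξ₀ (Fin.last n) = 1)
    {v : Fin (n + 1) → ℝ} (hv : v ∈ K) :
    ∃ ξ ∈ K, ξ (Fin.last n) = 1 ∧ v = v (Fin.last n) • ξ ∧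
      (v (Fin.last n) = 0 → ξ = ξ₀) := by
  rcases lt_trichotomy (v (Fin.last n)) 0 with h | h | h
  · refine ⟨ξ₀, h0, h01, ?_, fun _ => rfl⟩
    have hz := cpp_zero_of_last hKconv hKcone hcomp h0 h01
      (cpp_cone_add hKconv hKcone hv (hKcone (-v (Fin.last n)) (by linarith) _ h0))
      (by simp [h01])
    rw [neg_smul] at hz
    exact add_neg_eq_zero.mp hz
  · refine ⟨ξ₀, h0, h01, ?_, fun _ => rfl⟩
    rw [h, zero_smul]
    exact cpp_zero_of_last hKconv hKcone hcomp h0 h01 hv h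
  · refine ⟨(v (Fin.last n))⁻¹ • v, hKcone _ (by positivity) _ hv, ?_, ?_, ?_⟩
    · simp [h.ne']
    · rw [smul_smul, mul_inv_cancel₀ h.ne', one_smul]
    · intro h'; exact absurd h' h.ne'

lemma cpp_trace {n : ℕ} (C : Matrix (Fin n) (Fin n) ℝ) (x : Fin n → ℝ) :
    (C * vecMulVec x x).trace = x ⬝ᵥ C *ᵥ x := by
  rw [Matrix.mul_vecMulVec, Matrix.trace_vecMulVec, dotProduct_comm]

/-- Decomposition of feasible points of the completely positive program. -/
lemma cpp_feasible {n : ℕ} {K : Set (Fin (n + 1) → ℝ)} (hKconv : Convex ℝ K)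
    (hKcone : ∀ c : ℝ, 0 ≤ c → ∀ v ∈ K, c • v ∈ K)
    (hcomp : IsCompact {ξ ∈ K | ξ (Fin.last n) = 1})
    {ξ₀ : Fin (n + 1) → ℝ} (h0 : ξ₀ ∈ K) (h01 : ξ₀ (Fin.last n) = 1)
    (C : Matrix (Fin (n + 1)) (Fin (n + 1)) ℝ)
    {X : Matrix (Fin (n + 1)) (Fin (n + 1)) ℝ}
    (hX : IsCompletelyPositive K X) (hX1 : X (Fin.last n) (Fin.last n) = 1) :
    ∃ (m : ℕ) (w : Fin m → ℝ) (ξ : Fin m → Fin (n + 1) → ℝ),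
      (∀ i, 0 ≤ w i) ∧ (∑ i, w i = 1) ∧ (∀ i, ξ i ∈ K ∧ ξ i (Fin.last n) = 1) ∧
      (∀ i, w i = 0 → ξ i = ξ₀) ∧
      ((C * X).trace = ∑ i, w i * (ξ i ⬝ᵥ C *ᵥ ξ i)) ∧
      ((fun j => X j (Fin.last n)) = ∑ i, w i • ξ i) := by
  obtain ⟨m, x, hx, rfl⟩ := hX
  choose ξ hξK hξ1 hxξ hξ0 using fun i =>
    cpp_decomp hKconv hKcone hcomp h0 h01 (hx i)
  refine ⟨m, fun i => x i (Fin.last n) * x i (Fin.last n), ξ,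
    fun i => mul_self_nonneg _, ?_, fun i => ⟨hξK i, hξ1 i⟩,
    fun i hi => hξ0 i (mul_self_eq_zero.mp hi), ?_, ?_⟩
  · simpa [Matrix.sum_apply, vecMulVec_apply] using hX1
  · rw [Matrix.mul_sum, Matrix.trace_sum]
    refine Finset.sum_congr rfl fun i _ => ?_
    rw [cpp_trace]
    conv_lhs => rw [hxξ i]
    rw [Matrix.mulVec_smul, smul_dotProduct, dotProduct_smul, smul_eq_mul, smul_eq_mul]
    ring
  · ext j
    simp only [Matrix.sum_apply, vecMulVec_apply, Finset.sum_apply, Pi.smul_apply, smul_eq_mul]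
    refine Finset.sum_congr rfl fun i _ => ?_
    have := congrFun (hxξ i) j
    simp only [Pi.smul_apply, smul_eq_mul] at this
    linear_combination (x i (Fin.last n)) * this

end CppHelpers

/-- **Optimal solutions of the completely positive reformulation yield points in the convex
hull of optimizers of the quadratic program.** If `X*` is optimal for the completely positive
program, then the last column of `X*` lies in the convex hull of the set of maximizers of
`ξ ↦ ξᵀCξ` over the unit slice `Ξ` of `K`. -/
theorem cpp_optimal_solution_in_convex_hull_of_maximizers
    (n : ℕ) (K : Set (Fin (n + 1) → ℝ))
    (hKclosed : IsClosed K) (hKconv : Convex ℝ K)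
    (hKcone : ∀ c : ℝ, 0 ≤ c → ∀ v ∈ K, c • v ∈ K)
    (hΞne : {ξ ∈ K | ξ (Fin.last n) = 1}.Nonempty)
    (hΞcomp : IsCompact {ξ ∈ K | ξ (Fin.last n) = 1})
    (C : Matrix (Fin (n + 1)) (Fin (n + 1)) ℝ) (hC : C.IsSymm)
    (Xstar : Matrix (Fin (n + 1)) (Fin (n + 1)) ℝ)
    (hXcp : IsCompletelyPositive K Xstar)
    (hXcorner : Xstar (Fin.last n) (Fin.last n) = 1)
    (hXopt : (C * Xstar).trace = sSup {r : ℝ | ∃ X, IsCompletelyPositive K X ∧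
        X (Fin.last n) (Fin.last n) = 1 ∧ r = (C * X).trace}) :
    (fun i => Xstar i (Fin.last n)) ∈
      convexHull ℝ {ξ | ξ ∈ K ∧ ξ (Fin.last n) = 1 ∧
        ξ ⬝ᵥ C *ᵥ ξ =
          sSup ((fun ξ' => ξ' ⬝ᵥ C *ᵥ ξ') '' {ξ' ∈ K | ξ' (Fin.last n) = 1})} := by
  obtain ⟨ξs, ⟨hsK, hs1⟩, hmax⟩ := hΞcomp.exists_isMaxOn hΞne
    (f := fun ξ => ξ ⬝ᵥ C *ᵥ ξ) (by fun_prop)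
  have hle : ∀ ξ, ξ ∈ K → ξ (Fin.last n) = 1 → ξ ⬝ᵥ C *ᵥ ξ ≤ ξs ⬝ᵥ C *ᵥ ξs :=
    fun ξ h1 h2 => hmax (show ξ ∈ {ξ ∈ K | ξ (Fin.last n) = 1} from ⟨h1, h2⟩)
  have hsup : sSup ((fun ξ' => ξ' ⬝ᵥ C *ᵥ ξ') '' {ξ' ∈ K | ξ' (Fin.last n) = 1})
      = ξs ⬝ᵥ C *ᵥ ξs := by
    apply IsGreatest.csSup_eq
    refine ⟨⟨ξs, ⟨hsK, hs1⟩, rfl⟩, ?_⟩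
    rintro _ ⟨ξ, ⟨h1, h2⟩, rfl⟩
    exact hle ξ h1 h2
  rw [hsup]
  have hsup2 : sSup {r : ℝ | ∃ X, IsCompletelyPositive K X ∧
        X (Fin.last n) (Fin.last n) = 1 ∧ r = (C * X).trace} = ξs ⬝ᵥ C *ᵥ ξs := by
    apply IsGreatest.csSup_eq
    refine ⟨⟨vecMulVec ξs ξs, ⟨1, fun _ => ξs, fun _ => hsK, by simp⟩, ?_,
      (cpp_trace C ξs).symm⟩, ?_⟩
    · simp [vecMulVec_apply, hs1]
    · rintro _ ⟨X, hX, hX1, rfl⟩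
      obtain ⟨m, w, ξ, hw, hw1, hξ, -, htr, -⟩ :=
        cpp_feasible hKconv hKcone hΞcomp hsK hs1 C hX hX1
      rw [htr]
      calc ∑ i, w i * (ξ i ⬝ᵥ C *ᵥ ξ i) ≤ ∑ i, w i * (ξs ⬝ᵥ C *ᵥ ξs) :=
            Finset.sum_le_sum fun i _ =>
              mul_le_mul_of_nonneg_left (hle _ (hξ i).1 (hξ i).2) (hw i)
        _ = ξs ⬝ᵥ C *ᵥ ξs := by rw [← Finset.sum_mul, hw1, one_mul]
  obtain ⟨m, w, ξ, hw, hw1, hξ, hξ0, htr, hcol⟩ :=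
    cpp_feasible hKconv hKcone hΞcomp hsK hs1 C hXcp hXcorner
  rw [hsup2, htr] at hXopt
  have hz : ∑ i, w i * (ξs ⬝ᵥ C *ᵥ ξs - ξ i ⬝ᵥ C *ᵥ ξ i) = 0 := by
    simp only [mul_sub, Finset.sum_sub_distrib]
    rw [hXopt, ← Finset.sum_mul, hw1, one_mul, sub_self]
  rw [Finset.sum_eq_zero_iff_of_nonneg fun i _ =>
    mul_nonneg (hw i) (sub_nonneg.mpr (hle _ (hξ i).1 (hξ i).2))] at hz
  rw [hcol]
  refine (convex_convexHull ℝ _).sum_mem (fun i _ => hw i) hw1 fun i _ =>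
    subset_convexHull ℝ _ ⟨(hξ i).1, (hξ i).2, ?_⟩
  rcases mul_eq_zero.mp (hz i (Finset.mem_univ i)) with h | h
  · rw [hξ0 i h]
  · linarith
end

section
/- Let K ⊆ ℝ^n be a closed convex cone whose unit slice Ξ = { ξ ∈ K : ξ_n = 1 } is nonempty and compact. Then sup { tr(CX) : X ∈ C*(K) and e_nᵀ X e_n = 1 } = inf { u ∈ ℝ : u e_n e_nᵀ − C ∈ C(K) } for every symmetric n×n real matrix C, i.e., strong duality holds between the completely positive program and its dual copositive program. -/
open Matrix

/-- `M` belongs to the (generalized) copositive cone `C(K)`: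
`M` is symmetric and `vᵀMv ≥ 0` for all `v ∈ K`. -/
def IsCopositive {n : ℕ} (K : Set (Fin n → ℝ))
    (M : Matrix (Fin n) (Fin n) ℝ) : Prop :=
  M.IsSymm ∧ ∀ v ∈ K, 0 ≤ v ⬝ᵥ M *ᵥ v

theorem slice_quad_bound
    (n : ℕ) (K : Set (Fin (n + 1) → ℝ)) (hKconv : Convex ℝ K)
    (hKcone : ∀ c : ℝ, 0 ≤ c → ∀ v ∈ K, c • v ∈ K)
    (hΞne : {ξ ∈ K | ξ (Fin.last n) = 1}.Nonempty)
    (hΞcomp : IsCompact {ξ ∈ K | ξ (Fin.last n) = 1}) (v : Fin (n + 1) → ℝ) (hv : v ∈ K) :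
    ∃ ξ ∈ {ξ ∈ K | ξ (Fin.last n) = 1}, v = v (Fin.last n) • ξ := by
  have hadd : ∀ a ∈ K, ∀ b ∈ K, a + b ∈ K := by
    intro a ha b hb
    have h := hKconv (hKcone 2 (by norm_num) a ha) (hKcone 2 (by norm_num) b hb)
      (by norm_num : (0 : ℝ) ≤ 1 / 2) (by norm_num : (0 : ℝ) ≤ 1 / 2) (by norm_num)
    simpa [smul_smul] using h
  obtain ⟨ξ₀, hξ₀, hξ₀1⟩ := hΞne
  have hzero : ∀ w ∈ K, w (Fin.last n) = 0 → w = 0 := by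
    intro w hw hw0
    obtain ⟨R, hR⟩ := hΞcomp.isBounded.exists_norm_le
    by_contra hne
    have hpos : 0 < ‖w‖ := norm_pos_iff.mpr hne
    have hR0 : 0 ≤ R := (norm_nonneg _).trans (hR ξ₀ ⟨hξ₀, hξ₀1⟩)
    have ht : 0 ≤ (2 * R + 1) / ‖w‖ := by positivity
    have h1 := hR (ξ₀ + ((2 * R + 1) / ‖w‖) • w)
      ⟨hadd _ hξ₀ _ (hKcone _ ht _ hw), by simp [hw0, hξ₀1]⟩
    have h0 := hR ξ₀ ⟨hξ₀, hξ₀1⟩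
    have h2 : ‖((2 * R + 1) / ‖w‖) • w‖ = 2 * R + 1 := by
      rw [norm_smul, Real.norm_of_nonneg ht]
      field_simp
    have h3 := norm_sub_le (ξ₀ + ((2 * R + 1) / ‖w‖) • w) ξ₀
    rw [add_sub_cancel_left, h2] at h3
    linarith
  rcases lt_trichotomy (v (Fin.last n)) 0 with h | h | h
  · refine ⟨ξ₀, ⟨hξ₀, hξ₀1⟩, ?_⟩
    have h1 := hzero (v + (-v (Fin.last n)) • ξ₀)
      (hadd _ hv _ (hKcone _ (by linarith) _ hξ₀)) (by simp [hξ₀1])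
    rw [neg_smul, ← sub_eq_add_neg] at h1
    exact sub_eq_zero.mp h1
  · exact ⟨ξ₀, ⟨hξ₀, hξ₀1⟩, by rw [h, zero_smul]; exact hzero v hv h⟩
  · refine ⟨(v (Fin.last n))⁻¹ • v, ⟨hKcone _ (by positivity) _ hv, ?_⟩, ?_⟩
    · simp [h.ne']
    · rw [smul_smul, mul_inv_cancel₀ h.ne', one_smul]

theorem trace_mul_cp {n m : ℕ} (C : Matrix (Fin n) (Fin n) ℝ) (x : Fin m → (Fin n → ℝ)) :
    (C * ∑ i, vecMulVec (x i) (x i)).trace = ∑ i, x i ⬝ᵥ C *ᵥ x i := by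
  rw [Matrix.mul_sum, Matrix.trace_sum]
  refine Finset.sum_congr rfl fun i _ => ?_
  rw [Matrix.mul_vecMulVec, Matrix.trace_vecMulVec, dotProduct_comm]

theorem corner_cp {n m : ℕ} (x : Fin m → (Fin (n + 1) → ℝ)) :
    (Pi.single (Fin.last n) 1 : Fin (n + 1) → ℝ) ⬝ᵥ
      (∑ i, vecMulVec (x i) (x i)) *ᵥ (Pi.single (Fin.last n) 1 : Fin (n + 1) → ℝ)
      = ∑ i, x i (Fin.last n) ^ 2 := by
  simp [Matrix.sum_apply, vecMulVec_apply, pow_two]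

theorem dual_quad {n : ℕ} (u : ℝ) (C : Matrix (Fin (n + 1)) (Fin (n + 1)) ℝ)
    (v : Fin (n + 1) → ℝ) :
    v ⬝ᵥ (u • vecMulVec (Pi.single (Fin.last n) 1 : Fin (n + 1) → ℝ)
                (Pi.single (Fin.last n) 1 : Fin (n + 1) → ℝ) - C) *ᵥ v
      = u * v (Fin.last n) ^ 2 - v ⬝ᵥ C *ᵥ v := by
  rw [sub_mulVec, dotProduct_sub, smul_mulVec, dotProduct_smul, vecMulVec_mulVec]
  simp [pow_two]

/-- **Strong duality between the completely positive program and its dual copositive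
program.** If `K ⊆ ℝ^{n+1}` is a closed convex cone whose unit slice is nonempty and compact,
then for every symmetric `C`,
`sup { tr(CX) : X ∈ C*(K), e_nᵀXe_n = 1 } = inf { u : u e_n e_nᵀ − C ∈ C(K) }`. -/
theorem cpp_cop_strong_duality
    (n : ℕ) (K : Set (Fin (n + 1) → ℝ))
    (hKclosed : IsClosed K) (hKconv : Convex ℝ K)
    (hKcone : ∀ c : ℝ, 0 ≤ c → ∀ v ∈ K, c • v ∈ K)
    (hΞne : {ξ ∈ K | ξ (Fin.last n) = 1}.Nonempty)
    (hΞcomp : IsCompact {ξ ∈ K | ξ (Fin.last n) = 1}) :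
    ∀ C : Matrix (Fin (n + 1)) (Fin (n + 1)) ℝ, C.IsSymm →
      sSup {r : ℝ | ∃ X, IsCompletelyPositive K X ∧
          (Pi.single (Fin.last n) 1 : Fin (n + 1) → ℝ) ⬝ᵥ
            X *ᵥ (Pi.single (Fin.last n) 1 : Fin (n + 1) → ℝ) = 1 ∧
          r = (C * X).trace}
        = sInf {u : ℝ | IsCopositive K
            (u • vecMulVec (Pi.single (Fin.last n) 1 : Fin (n + 1) → ℝ)
                (Pi.single (Fin.last n) 1 : Fin (n + 1) → ℝ) - C)} := by
  intro C hC
  have hcont : Continuous fun v : Fin (n + 1) → ℝ => v ⬝ᵥ C *ᵥ v := by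
    fun_prop
  obtain ⟨ξ, ⟨hξK, hξ1⟩, hmax⟩ := hΞcomp.exists_isMaxOn hΞne hcont.continuousOn
  have key : ∀ v ∈ K, v ⬝ᵥ C *ᵥ v ≤ (ξ ⬝ᵥ C *ᵥ ξ) * v (Fin.last n) ^ 2 := by
    intro v hv
    obtain ⟨η, hη, hvη⟩ := slice_quad_bound n K hKconv hKcone hΞne hΞcomp v hv
    have h1 : η ⬝ᵥ C *ᵥ η ≤ ξ ⬝ᵥ C *ᵥ ξ := hmax hη
    have h2 : v ⬝ᵥ C *ᵥ v = (η ⬝ᵥ C *ᵥ η) * v (Fin.last n) ^ 2 := by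
      generalize v (Fin.last n) = t at hvη
      subst hvη
      simp only [mulVec_smul, smul_dotProduct, dotProduct_smul, smul_eq_mul]
      ring
    rw [h2]
    exact mul_le_mul_of_nonneg_right h1 (sq_nonneg _)
  have hP : IsGreatest {r : ℝ | ∃ X, IsCompletelyPositive K X ∧
          (Pi.single (Fin.last n) 1 : Fin (n + 1) → ℝ) ⬝ᵥ
            X *ᵥ (Pi.single (Fin.last n) 1 : Fin (n + 1) → ℝ) = 1 ∧
          r = (C * X).trace} (ξ ⬝ᵥ C *ᵥ ξ) := by
    constructor
    · refine ⟨_, ⟨1, fun _ => ξ, fun _ => hξK, rfl⟩, ?_, ?_⟩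
      · rw [corner_cp]; simp [hξ1]
      · rw [trace_mul_cp]; simp
    · rintro r ⟨X, ⟨m, x, hx, rfl⟩, h1, rfl⟩
      rw [corner_cp] at h1
      rw [trace_mul_cp]
      calc _ ≤ ∑ i, (ξ ⬝ᵥ C *ᵥ ξ) * x i (Fin.last n) ^ 2 :=
            Finset.sum_le_sum fun i _ => key _ (hx i)
        _ = _ := by rw [← Finset.mul_sum, h1, mul_one]
  have hD : IsLeast {u : ℝ | IsCopositive K
            (u • vecMulVec (Pi.single (Fin.last n) 1 : Fin (n + 1) → ℝ)
                (Pi.single (Fin.last n) 1 : Fin (n + 1) → ℝ) - C)} (ξ ⬝ᵥ C *ᵥ ξ) := by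
    constructor
    · refine ⟨?_, fun v hv => ?_⟩
      · refine IsSymm.sub (IsSymm.smul ?_ _) hC
        exact transpose_vecMulVec _ _
      · rw [dual_quad]
        linarith [key v hv]
    · rintro u ⟨-, hu⟩
      have h := hu ξ hξK
      rw [dual_quad, hξ1] at h
      linarith
  rw [hP.csSup_eq, hD.csInf_eq]
end

section
/- Let K ⊆ ℝ^n be a closed convex cone whose unit slice Ξ = { ξ ∈ K : ξ_n = 1 } is nonempty and compact, let M be a symmetric n×n real matrix, and let c ∈ ℝ. Then ξᵀMξ + c ≥ 0 for all ξ ∈ Ξ if and only if there exists π ∈ ℝ with π + c ≥ 0 and M − π e_n e_nᵀ ∈ C(K). -/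
open Matrix

/-- **Copositive certificate for nonnegativity of a quadratic on the unit slice of a cone.**
If `K ⊆ ℝ^{n+1}` is a closed convex cone with nonempty compact unit slice `Ξ`, `M` symmetric
and `c ∈ ℝ`, then `ξᵀMξ + c ≥ 0` on `Ξ` iff there is `π ∈ ℝ` with `π + c ≥ 0` and
`M − π e_n e_nᵀ ∈ C(K)`. -/
theorem quadratic_nonneg_iff_copositive_certificate
    (n : ℕ) (K : Set (Fin (n + 1) → ℝ))
    (hKclosed : IsClosed K) (hKconv : Convex ℝ K)
    (hKcone : ∀ c : ℝ, 0 ≤ c → ∀ v ∈ K, c • v ∈ K)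
    (hΞne : {ξ ∈ K | ξ (Fin.last n) = 1}.Nonempty)
    (hΞcomp : IsCompact {ξ ∈ K | ξ (Fin.last n) = 1})
    (M : Matrix (Fin (n + 1)) (Fin (n + 1)) ℝ) (hM : M.IsSymm) (c : ℝ) :
    (∀ ξ ∈ K, ξ (Fin.last n) = 1 → 0 ≤ ξ ⬝ᵥ M *ᵥ ξ + c)
      ↔ ∃ π : ℝ, 0 ≤ π + c ∧ IsCopositive K
          (M - π • vecMulVec (Pi.single (Fin.last n) 1 : Fin (n + 1) → ℝ)
              (Pi.single (Fin.last n) 1 : Fin (n + 1) → ℝ)) := by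
  have hadd : ∀ x ∈ K, ∀ y ∈ K, x + y ∈ K := by
    intro x hx y hy
    have h := hKconv hx hy (by norm_num : (0:ℝ) ≤ 1/2) (by norm_num : (0:ℝ) ≤ 1/2) (by norm_num)
    have h2 := hKcone 2 (by norm_num) _ h
    have e : (2:ℝ) • ((1/2:ℝ) • x + (1/2:ℝ) • y) = x + y := by
      ext i; simp; ring
    rwa [e] at h2
  obtain ⟨ξ, hξK, hξ1⟩ := hΞne
  obtain ⟨C, hC⟩ := hΞcomp.isBounded.exists_norm_le
  have hzero : ∀ w ∈ K, w (Fin.last n) = 0 → w = 0 := by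
    intro w hw hw0
    by_contra hne
    have hpos : 0 < ‖w‖ := norm_pos_iff.mpr hne
    have hC0 : ‖ξ‖ ≤ C := hC ξ ⟨hξK, hξ1⟩
    have hCn : 0 ≤ C := (norm_nonneg _).trans hC0
    have hs : 0 ≤ (2 * C + 1) / ‖w‖ := by positivity
    have h1 := hC (ξ + ((2 * C + 1) / ‖w‖) • w)
      ⟨hadd _ hξK _ (hKcone _ hs _ hw), by simp [hξ1, hw0]⟩
    have h2 : ‖((2 * C + 1) / ‖w‖) • w‖ = 2 * C + 1 := by
      rw [norm_smul, Real.norm_of_nonneg hs]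
      field_simp
    have h3 := norm_sub_le (ξ + ((2 * C + 1) / ‖w‖) • w) ξ
    rw [add_sub_cancel_left, h2] at h3
    linarith
  have hrep : ∀ v ∈ K, ∃ x ∈ K, x (Fin.last n) = 1 ∧ v = v (Fin.last n) • x := by
    intro v hv
    rcases lt_trichotomy (v (Fin.last n)) 0 with h | h | h
    · refine ⟨ξ, hξK, hξ1, ?_⟩
      have hw := hzero (v + (-v (Fin.last n)) • ξ)
        (hadd _ hv _ (hKcone _ (by linarith) _ hξK)) (by simp [hξ1])
      rw [neg_smul, ← sub_eq_add_neg] at hw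
      exact sub_eq_zero.mp hw
    · refine ⟨ξ, hξK, hξ1, ?_⟩
      rw [h, zero_smul]
      exact hzero v hv h
    · refine ⟨(v (Fin.last n))⁻¹ • v, hKcone _ (by positivity) _ hv, ?_, ?_⟩
      · simp [h.ne']
      · rw [smul_smul, mul_inv_cancel₀ h.ne', one_smul]
  have hq : ∀ (p : ℝ) (v : Fin (n + 1) → ℝ),
      v ⬝ᵥ (M - p • vecMulVec (Pi.single (Fin.last n) 1 : Fin (n + 1) → ℝ)
              (Pi.single (Fin.last n) 1 : Fin (n + 1) → ℝ)) *ᵥ v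
        = v ⬝ᵥ M *ᵥ v - p * v (Fin.last n) ^ 2 := by
    intro p v
    rw [sub_mulVec, dotProduct_sub, smul_mulVec, dotProduct_smul, vecMulVec_mulVec]
    simp
    left
    ring
  constructor
  · intro H
    refine ⟨-c, by simp, ?_, ?_⟩
    · refine hM.sub ?_
      unfold Matrix.IsSymm
      rw [transpose_smul, transpose_vecMulVec]
    · intro v hv
      rw [hq]
      obtain ⟨x, hx, hx1, hvx⟩ := hrep v hv
      have h0 := H x hx hx1
      have e : v ⬝ᵥ M *ᵥ v = v (Fin.last n) ^ 2 * (x ⬝ᵥ M *ᵥ x) := by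
        generalize v (Fin.last n) = t at hvx
        subst hvx
        rw [mulVec_smul, dotProduct_smul, smul_dotProduct]
        simp only [smul_eq_mul]
        ring
      rw [e]
      nlinarith [mul_nonneg (sq_nonneg (v (Fin.last n))) h0]
  · rintro ⟨p, hp, -, H⟩ x hx hx1
    have h := H x hx
    rw [hq, hx1] at h
    linarith
end

section
/- Let K ⊆ ℝ^n be a closed convex cone whose unit slice Ξ = { ξ ∈ K : ξ_n = 1 } is nonempty and compact, and let W_1, …, W_L be real m×n matrices. Then there exists Y ∈ ℝ^{m×n} such that (W_ℓ ξ)ᵀ (Y ξ) > 0 for all ξ ∈ Ξ and all ℓ ∈ {1,…,L} if and only if there exist Y ∈ ℝ^{m×n} and β_1, …, β_L > 0 such that (1/2)(YᵀW_ℓ + W_ℓᵀY) − β_ℓ e_n e_nᵀ ∈ C(K) for all ℓ ∈ {1,…,L}. -/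
open Matrix

lemma aux_slice {n : ℕ} {K : Set (Fin (n + 1) → ℝ)} (hKconv : Convex ℝ K)
    (hKcone : ∀ c : ℝ, 0 ≤ c → ∀ v ∈ K, c • v ∈ K)
    (hne : {ξ ∈ K | ξ (Fin.last n) = 1}.Nonempty)
    (hcomp : IsCompact {ξ ∈ K | ξ (Fin.last n) = 1}) (v : Fin (n + 1) → ℝ) (hv : v ∈ K) :
    ∃ ξ ∈ K, ξ (Fin.last n) = 1 ∧ v = v (Fin.last n) • ξ := by
  obtain ⟨ξ₀, hξ₀, h1⟩ := hne
  have hadd : ∀ a ∈ K, ∀ b ∈ K, a + b ∈ K := by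
    intro a ha b hb
    have := hKcone 2 (by norm_num) _
      (hKconv ha hb (show (0:ℝ) ≤ 1/2 by norm_num) (show (0:ℝ) ≤ 1/2 by norm_num) (by norm_num))
    convert this using 1
    ext i; simp; ring
  have hzero : ∀ w ∈ K, w (Fin.last n) = 0 → w = 0 := by
    intro w hw hw0
    obtain ⟨C, hC⟩ := hcomp.isBounded.exists_norm_le
    ext i
    by_contra hi
    have hi' : 0 < |w i| := abs_pos.mpr hi
    set t : ℝ := (C + |ξ₀ i| + 1) / |w i| with ht
    have hC0 : 0 ≤ C := (norm_nonneg _).trans (hC ξ₀ ⟨hξ₀, h1⟩)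
    have ht0 : 0 ≤ t := by positivity
    have hmem := hC (ξ₀ + t • w) ⟨hadd _ hξ₀ _ (hKcone t ht0 w hw), by simp [h1, hw0]⟩
    have h2 := (norm_le_pi_norm (ξ₀ + t • w) i).trans hmem
    simp only [Pi.add_apply, Pi.smul_apply, smul_eq_mul, Real.norm_eq_abs] at h2
    have h3 : |t * w i| = C + |ξ₀ i| + 1 := by
      rw [abs_mul, abs_of_nonneg ht0, ht]; field_simp
    have h4 := abs_sub (ξ₀ i + t * w i) (ξ₀ i)
    rw [add_sub_cancel_left] at h4
    linarith
  rcases lt_trichotomy (v (Fin.last n)) 0 with h | h | h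
  · refine ⟨ξ₀, hξ₀, h1, ?_⟩
    have := hzero _ (hadd _ (hKcone (-v (Fin.last n)) (by linarith) _ hξ₀) _ hv) (by simp [h1])
    ext i
    have := congrFun this i
    simp at this ⊢
    linarith
  · exact ⟨ξ₀, hξ₀, h1, by rw [hzero v hv h]; simp⟩
  · refine ⟨(v (Fin.last n))⁻¹ • v, hKcone _ (by positivity) _ hv, ?_, ?_⟩
    · simp [h.ne']
    · rw [smul_smul, mul_inv_cancel₀ h.ne', one_smul]

lemma aux_quad {n m : ℕ} (Y W : Matrix (Fin m) (Fin (n + 1)) ℝ) (b : ℝ) (v : Fin (n + 1) → ℝ) :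
    v ⬝ᵥ ((1 / 2 : ℝ) • (Yᵀ * W + Wᵀ * Y)
              - b • vecMulVec (Pi.single (Fin.last n) 1 : Fin (n + 1) → ℝ)
                  (Pi.single (Fin.last n) 1 : Fin (n + 1) → ℝ)) *ᵥ v
      = (W *ᵥ v) ⬝ᵥ (Y *ᵥ v) - b * v (Fin.last n) ^ 2 := by
  have e1 : v ⬝ᵥ (Yᵀ * W) *ᵥ v = (W *ᵥ v) ⬝ᵥ (Y *ᵥ v) := by
    rw [← mulVec_mulVec, dotProduct_mulVec, vecMul_transpose, dotProduct_comm]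
  have e2 : v ⬝ᵥ (Wᵀ * Y) *ᵥ v = (W *ᵥ v) ⬝ᵥ (Y *ᵥ v) := by
    rw [← mulVec_mulVec, dotProduct_mulVec, vecMul_transpose]
  rw [sub_mulVec, smul_mulVec, smul_mulVec, add_mulVec, dotProduct_sub, dotProduct_smul,
    dotProduct_smul, dotProduct_add, e1, e2, vecMulVec_mulVec]
  simp
  ring

/-- **Copositive characterization of complete recourse under linear decision rules.**
Let `K ⊆ ℝ^{n+1}` be a closed convex cone with nonempty compact unit slice
`Ξ = {ξ ∈ K : ξ_last = 1}` and let `W_1, …, W_L` be `m × (n+1)` matrices. There exists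
`Y` with `(W_ℓ ξ)ᵀ(Yξ) > 0` for all `ξ ∈ Ξ` and all `ℓ` iff there exist `Y` and
`β_ℓ > 0` with `(1/2)(YᵀW_ℓ + W_ℓᵀY) − β_ℓ e eᵀ ∈ C(K)` for all `ℓ`. -/
theorem complete_recourse_ldr_copositive_characterization
    (n m L : ℕ) (K : Set (Fin (n + 1) → ℝ))
    (hKclosed : IsClosed K) (hKconv : Convex ℝ K)
    (hKcone : ∀ c : ℝ, 0 ≤ c → ∀ v ∈ K, c • v ∈ K)
    (hΞne : {ξ ∈ K | ξ (Fin.last n) = 1}.Nonempty)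
    (hΞcomp : IsCompact {ξ ∈ K | ξ (Fin.last n) = 1})
    (W : Fin L → Matrix (Fin m) (Fin (n + 1)) ℝ) :
    (∃ Y : Matrix (Fin m) (Fin (n + 1)) ℝ,
        ∀ ξ ∈ K, ξ (Fin.last n) = 1 → ∀ ℓ, 0 < (W ℓ *ᵥ ξ) ⬝ᵥ (Y *ᵥ ξ))
      ↔ (∃ (Y : Matrix (Fin m) (Fin (n + 1)) ℝ) (β : Fin L → ℝ),
          (∀ ℓ, 0 < β ℓ) ∧ ∀ ℓ, IsCopositive K
            ((1 / 2 : ℝ) • (Yᵀ * W ℓ + (W ℓ)ᵀ * Y)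
              - β ℓ • vecMulVec (Pi.single (Fin.last n) 1 : Fin (n + 1) → ℝ)
                  (Pi.single (Fin.last n) 1 : Fin (n + 1) → ℝ))) := by
  constructor
  · rintro ⟨Y, hY⟩
    have hb : ∀ ℓ, ∃ b : ℝ, 0 < b ∧ ∀ ξ ∈ K, ξ (Fin.last n) = 1 →
        b ≤ (W ℓ *ᵥ ξ) ⬝ᵥ (Y *ᵥ ξ) := by
      intro ℓ
      obtain ⟨x, hx, hmin⟩ := hΞcomp.exists_isMinOn hΞne
        (f := fun ξ => (W ℓ *ᵥ ξ) ⬝ᵥ (Y *ᵥ ξ)) (by fun_prop)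
      exact ⟨_, hY x hx.1 hx.2 ℓ, fun ξ h1 h2 => hmin ⟨h1, h2⟩⟩
    choose β hβ hle using hb
    refine ⟨Y, β, hβ, fun ℓ => ⟨?_, fun v hv => ?_⟩⟩
    · unfold Matrix.IsSymm
      simp [transpose_vecMulVec, transpose_sub, transpose_add, transpose_mul, add_comm]
    · rw [aux_quad]
      obtain ⟨ξ, hξ, h1, h2⟩ := aux_slice hKconv hKcone hΞne hΞcomp v hv
      have h3 : (W ℓ *ᵥ v) ⬝ᵥ (Y *ᵥ v)
          = v (Fin.last n) ^ 2 * ((W ℓ *ᵥ ξ) ⬝ᵥ (Y *ᵥ ξ)) := by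
        generalize v (Fin.last n) = c at h2
        subst h2
        rw [mulVec_smul, mulVec_smul, smul_dotProduct, dotProduct_smul, smul_eq_mul, smul_eq_mul]
        ring
      rw [h3]
      nlinarith [hle ℓ ξ hξ h1, sq_nonneg (v (Fin.last n))]
  · rintro ⟨Y, β, hβ, h⟩
    refine ⟨Y, fun ξ hξ h1 ℓ => ?_⟩
    have := (h ℓ).2 ξ hξ
    rw [aux_quad, h1] at this
    linarith [hβ ℓ]
end

section
/- Let n = S+1, let P̂ be a real S_p×n matrix and R̂ a real S_r×n matrix, and let K = { ξ ∈ ℝ^{S} × ℝ_+ : P̂ξ ≥ 0 componentwise and R̂ξ ∈ SOC(S_r) }. Define M̂ = R̂ᵀ e_{S_r} e_{S_r}ᵀ R̂ − Σ_{ℓ=1}^{S_r − 1} R̂ᵀ e_ℓ e_ℓᵀ R̂. Suppose a symmetric n×n matrix V can be written as V = U + τ M̂ + P̂ᵀ Σ P̂ + (1/2)(P̂ᵀ Φ R̂ + R̂ᵀ Φᵀ P̂) for some positive semidefinite symmetric matrix U, some τ ≥ 0, some symmetric S_p×S_p matrix Σ with all entries nonnegative, and some S_p×S_r matrix Φ each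 of whose rows belongs to SOC(S_r). Then V ∈ C(K), i.e., vᵀVv ≥ 0 for all v ∈ K. -/
open Matrix

/-- The second-order cone `SOC(r+1) ⊆ ℝ^{r+1}`:
`‖(x_1,…,x_r)‖₂ ≤ x_{r+1}`. -/
noncomputable def SOC (r : ℕ) : Set (Fin (r + 1) → ℝ) :=
  {x | Real.sqrt (∑ i : Fin r, (x i.castSucc) ^ 2) ≤ x (Fin.last r)}

/-- The cone `K = { ξ ∈ ℝ^S × ℝ₊ : P̂ξ ≥ 0, R̂ξ ∈ SOC }`. -/
noncomputable def coneK (S Sp sr : ℕ) (P : Matrix (Fin Sp) (Fin (S + 1)) ℝ)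
    (R : Matrix (Fin (sr + 1)) (Fin (S + 1)) ℝ) : Set (Fin (S + 1) → ℝ) :=
  {ξ | 0 ≤ ξ (Fin.last S) ∧ (∀ i, 0 ≤ (P *ᵥ ξ) i) ∧ (R *ᵥ ξ) ∈ SOC sr}

/-- The matrix `M̂ = R̂ᵀ e_{S_r} e_{S_r}ᵀ R̂ − Σ_{ℓ<S_r} R̂ᵀ e_ℓ e_ℓᵀ R̂`. -/
noncomputable def Mhat (S sr : ℕ) (R : Matrix (Fin (sr + 1)) (Fin (S + 1)) ℝ) :
    Matrix (Fin (S + 1)) (Fin (S + 1)) ℝ :=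
  vecMulVec (R (Fin.last sr)) (R (Fin.last sr))
    - ∑ ℓ : Fin sr, vecMulVec (R ℓ.castSucc) (R ℓ.castSucc)

/-- Two vectors of the second-order cone have nonnegative inner product. -/
lemma SOC_dot_nonneg (r : ℕ) (x y : Fin (r + 1) → ℝ) (hx : x ∈ SOC r) (hy : y ∈ SOC r) :
    0 ≤ x ⬝ᵥ y := by
  simp only [SOC, Set.mem_setOf_eq] at hx hy
  have h1 := Real.sum_mul_le_sqrt_mul_sqrt Finset.univ
    (fun i : Fin r => - x i.castSucc) (fun i : Fin r => y i.castSucc)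
  simp only [neg_sq, neg_mul, Finset.sum_neg_distrib] at h1
  have h2 := mul_le_mul hx hy (Real.sqrt_nonneg _) ((Real.sqrt_nonneg _).trans hx)
  simp only [dotProduct, Fin.sum_univ_castSucc]
  linarith

/-- The quadratic form of `Mhat` is nonnegative when `R v` is in the second-order cone. -/
lemma Mhat_nonneg (S sr : ℕ) (R : Matrix (Fin (sr + 1)) (Fin (S + 1)) ℝ)
    (v : Fin (S + 1) → ℝ) (h : R *ᵥ v ∈ SOC sr) : 0 ≤ v ⬝ᵥ Mhat S sr R *ᵥ v := by
  have key : ∀ a : Fin (S + 1) → ℝ, v ⬝ᵥ vecMulVec a a *ᵥ v = (a ⬝ᵥ v) ^ 2 := by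
    intro a
    rw [vecMulVec_mulVec, dotProduct_smul, dotProduct_comm v a]
    simp [sq]
  simp only [SOC, Set.mem_setOf_eq] at h
  have h3 := (Real.sqrt_le_left ((Real.sqrt_nonneg _).trans h)).1 h
  have h4 : v ⬝ᵥ Mhat S sr R *ᵥ v
      = ((R *ᵥ v) (Fin.last sr)) ^ 2 - ∑ i : Fin sr, ((R *ᵥ v) i.castSucc) ^ 2 := by
    simp only [Mhat, sub_mulVec, dotProduct_sub, key, sum_mulVec, dotProduct_sum]
    rfl
  rw [h4]
  linarith

/-- **The inner approximation `IA₁(K)` consists of copositive matrices**: if a symmetric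
matrix `V` can be written as `V = U + τ M̂ + P̂ᵀ Σ P̂ + (1/2)(P̂ᵀ Φ R̂ + R̂ᵀ Φᵀ P̂)` with
`U ⪰ 0`, `τ ≥ 0`, `Σ` symmetric entrywise nonnegative, and each row of `Φ` in `SOC`, then
`vᵀVv ≥ 0` for all `v ∈ K`. -/
theorem IA1_subset_copositive
    (S Sp sr : ℕ) (Phat : Matrix (Fin Sp) (Fin (S + 1)) ℝ)
    (Rhat : Matrix (Fin (sr + 1)) (Fin (S + 1)) ℝ)
    (V U : Matrix (Fin (S + 1)) (Fin (S + 1)) ℝ)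
    (hVsym : V.IsSymm) (hU : U.PosSemidef)
    (τ : ℝ) (hτ : 0 ≤ τ)
    (Sig : Matrix (Fin Sp) (Fin Sp) ℝ) (hSigSym : Sig.IsSymm)
    (hSigNonneg : ∀ i j, 0 ≤ Sig i j)
    (Φ : Matrix (Fin Sp) (Fin (sr + 1)) ℝ) (hΦ : ∀ i, Φ i ∈ SOC sr)
    (hdecomp : V = U + τ • Mhat S sr Rhat + Phatᵀ * Sig * Phat
        + (1 / 2 : ℝ) • (Phatᵀ * Φ * Rhat + Rhatᵀ * Φᵀ * Phat)) :
    ∀ v ∈ coneK S Sp sr Phat Rhat, 0 ≤ v ⬝ᵥ V *ᵥ v := by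
  intro v hv
  obtain ⟨_, hP, hR⟩ := hv
  have hU' : 0 ≤ v ⬝ᵥ U *ᵥ v := by simpa using hU.dotProduct_mulVec_nonneg v
  have hM := mul_nonneg hτ (Mhat_nonneg S sr Rhat v hR)
  have hS : 0 ≤ v ⬝ᵥ (Phatᵀ * Sig * Phat) *ᵥ v := by
    rw [← mulVec_mulVec, ← mulVec_mulVec, dotProduct_mulVec, vecMul_transpose]
    refine Finset.sum_nonneg fun i _ => mul_nonneg (hP i) ?_
    change 0 ≤ ∑ j, Sig i j * (Phat *ᵥ v) j
    exact Finset.sum_nonneg fun j _ => mul_nonneg (hSigNonneg i j) (hP j)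
  have hF : 0 ≤ v ⬝ᵥ (Phatᵀ * Φ * Rhat) *ᵥ v := by
    rw [← mulVec_mulVec, ← mulVec_mulVec, dotProduct_mulVec, vecMul_transpose]
    exact Finset.sum_nonneg fun i _ => mul_nonneg (hP i)
      (SOC_dot_nonneg sr _ _ (hΦ i) hR)
  have hF' : v ⬝ᵥ (Rhatᵀ * Φᵀ * Phat) *ᵥ v = v ⬝ᵥ (Phatᵀ * Φ * Rhat) *ᵥ v := by
    have : Rhatᵀ * Φᵀ * Phat = (Phatᵀ * Φ * Rhat)ᵀ := by
      simp [transpose_mul, Matrix.mul_assoc]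
    rw [this, mulVec_transpose, dotProduct_comm, ← dotProduct_mulVec]
  rw [hdecomp]
  simp only [add_mulVec, smul_mulVec, dotProduct_add, dotProduct_smul, smul_eq_mul, hF']
  linarith
end

section
/- Let n = S+1, let P̂ be a real S_p×n matrix and R̂ a real S_r×n matrix, define M̂ = R̂ᵀ e_{S_r} e_{S_r}ᵀ R̂ − Σ_{ℓ=1}^{S_r − 1} R̂ᵀ e_ℓ e_ℓᵀ R̂, and suppose that some row of P̂ equals e_nᵀ. If a symmetric n×n matrix V can be written as V = U + τ M̂ + (1/2)(P̂ᵀ β e_nᵀ + e_n βᵀ P̂) with U positive semidefinite, τ ≥ 0, and β ∈ ℝ^{S_p} with β ≥ 0 (i.e., V ∈ IA_0), then V can also be written as V = U' + τ' M̂ + P̂ᵀ Σ P̂ + (1/2)(P̂ᵀ Φ R̂ + R̂ᵀ Φᵀ P̂) with U' positive semidefinite, τ' ≥ 0, Σ a symmetric entrywise-nonnegative S_p×S_p matrix, and Φ an S_p×S_r matrix each of whose rows lies in SOC(S_r) (i.e., V ∈ IA_1). -/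
open Matrix

/-- **`IA₀ ⊆ IA₁`** when some row of `P̂` equals `e_nᵀ`: any matrix admitting an `IA₀`
decomposition `V = U + τ M̂ + (1/2)(P̂ᵀ β e_nᵀ + e_n βᵀ P̂)` also admits an `IA₁`
decomposition `V = U' + τ' M̂ + P̂ᵀ Σ P̂ + (1/2)(P̂ᵀ Φ R̂ + R̂ᵀ Φᵀ P̂)`. -/
theorem IA0_subset_IA1
    (S Sp sr : ℕ) (Phat : Matrix (Fin Sp) (Fin (S + 1)) ℝ)
    (Rhat : Matrix (Fin (sr + 1)) (Fin (S + 1)) ℝ)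
    (hrow : ∃ i0 : Fin Sp, Phat i0 = (Pi.single (Fin.last S) 1 : Fin (S + 1) → ℝ))
    (V U : Matrix (Fin (S + 1)) (Fin (S + 1)) ℝ) (hU : U.PosSemidef)
    (τ : ℝ) (hτ : 0 ≤ τ) (β : Fin Sp → ℝ) (hβ : ∀ i, 0 ≤ β i)
    (hdecomp : V = U + τ • Mhat S sr Rhat
        + (1 / 2 : ℝ) • (vecMulVec (Phatᵀ *ᵥ β) (Pi.single (Fin.last S) 1)
            + vecMulVec (Pi.single (Fin.last S) 1 : Fin (S + 1) → ℝ) (Phatᵀ *ᵥ β))) :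
    ∃ (U' : Matrix (Fin (S + 1)) (Fin (S + 1)) ℝ) (τ' : ℝ)
      (Sig : Matrix (Fin Sp) (Fin Sp) ℝ) (Φ : Matrix (Fin Sp) (Fin (sr + 1)) ℝ),
      U'.PosSemidef ∧ 0 ≤ τ' ∧ Sig.IsSymm ∧ (∀ i j, 0 ≤ Sig i j) ∧
      (∀ i, Φ i ∈ SOC sr) ∧
      V = U' + τ' • Mhat S sr Rhat + Phatᵀ * Sig * Phat
        + (1 / 2 : ℝ) • (Phatᵀ * Φ * Rhat + Rhatᵀ * Φᵀ * Phat) := by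
  obtain ⟨i0, hi0⟩ := hrow
  have hcol : Phatᵀ *ᵥ (Pi.single i0 1 : Fin Sp → ℝ) = Pi.single (Fin.last S) 1 := by
    rw [← hi0, Matrix.mulVec_single_one]
    rfl
  have hrw : (Pi.single i0 1 : Fin Sp → ℝ) ᵥ* Phat = Pi.single (Fin.last S) 1 := by
    rw [← hcol, Matrix.mulVec_transpose]
  have hs : ∀ i, 0 ≤ (Pi.single i0 1 : Fin Sp → ℝ) i := by
    intro i
    by_cases h : i = i0
    · subst h; simp
    · simp [h]
  refine ⟨U, τ, (1 / 2 : ℝ) • (vecMulVec β (Pi.single i0 1) + vecMulVec (Pi.single i0 1) β),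
    0, hU, hτ, ?_, ?_, ?_, ?_⟩
  · ext i j
    simp only [Matrix.transpose_apply, Matrix.smul_apply, Matrix.add_apply, vecMulVec_apply,
      smul_eq_mul]
    ring
  · intro i j
    simp only [Matrix.smul_apply, Matrix.add_apply, vecMulVec_apply, smul_eq_mul]
    have h1 := mul_nonneg (hβ i) (hs j)
    have h2 := mul_nonneg (hs i) (hβ j)
    linarith
  · intro i
    simp [SOC]
  · rw [hdecomp, Matrix.mul_smul, Matrix.smul_mul, Matrix.mul_add, Matrix.add_mul,
      mul_vecMulVec, mul_vecMulVec, vecMulVec_mul, vecMulVec_mul, hcol, hrw,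
      ← Matrix.mulVec_transpose]
    simp
end

section
/- Let n = S+1, let P̂ be a real S_p×n matrix and R̂ a real S_r×n matrix, let K = { ξ ∈ ℝ^{S} × ℝ_+ : P̂ξ ≥ 0 componentwise and R̂ξ ∈ SOC(S_r) }, and define M̂ = R̂ᵀ e_{S_r} e_{S_r}ᵀ R̂ − Σ_{ℓ=1}^{S_r − 1} R̂ᵀ e_ℓ e_ℓᵀ R̂. Then every F ∈ C*(K) satisfies: F is positive semidefinite, tr(F M̂) ≥ 0, all entries of P̂ F P̂ᵀ are nonnegative, and every row of P̂ F R̂ᵀ belongs to SOC(S_r). -/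
open Matrix

lemma SOC_iff (r : ℕ) (x : Fin (r + 1) → ℝ) :
    x ∈ SOC r ↔ ‖WithLp.toLp 2 (fun i : Fin r => x i.castSucc)‖ ≤ x (Fin.last r) := by
  simp [SOC, EuclideanSpace.norm_eq]

lemma SOC_sum_smul (r m : ℕ) (c : Fin m → ℝ) (hc : ∀ k, 0 ≤ c k)
    (y : Fin m → Fin (r + 1) → ℝ) (hy : ∀ k, y k ∈ SOC r) :
    (fun j => ∑ k, c k * y k j) ∈ SOC r := by
  rw [SOC_iff]
  have h : (WithLp.toLp 2 (fun i : Fin r => ∑ k, c k * y k i.castSucc))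
      = ∑ k, c k • WithLp.toLp 2 (fun i : Fin r => y k i.castSucc) := by
    ext i
    simp
  rw [h]
  refine (norm_sum_le _ _).trans (Finset.sum_le_sum fun k _ => ?_)
  rw [norm_smul, Real.norm_of_nonneg (hc k)]
  exact mul_le_mul_of_nonneg_left ((SOC_iff r (y k)).1 (hy k)) (hc k)

lemma sandwich_apply {n m p q : ℕ} (A : Matrix (Fin p) (Fin n) ℝ) (B : Matrix (Fin q) (Fin n) ℝ)
    (x : Fin m → Fin n → ℝ) (i : Fin p) (j : Fin q) :
    (A * (∑ k, vecMulVec (x k) (x k)) * Bᵀ) i j = ∑ k, (A *ᵥ x k) i * (B *ᵥ x k) j := by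
  rw [Matrix.mul_sum, Matrix.sum_mul, Matrix.sum_apply]
  refine Finset.sum_congr rfl fun k _ => ?_
  rw [Matrix.mul_vecMulVec, Matrix.vecMulVec_mul, Matrix.vecMul_transpose, vecMulVec_apply]

lemma trace_aux {n : ℕ} (x r : Fin n → ℝ) :
    (vecMulVec x x * vecMulVec r r).trace = (r ⬝ᵥ x) ^ 2 := by
  rw [Matrix.vecMulVec_mul_vecMulVec, Matrix.trace_vecMulVec, dotProduct_smul, smul_eq_mul,
    dotProduct_comm x r, sq]

/-- **`C*(K) ⊆ OA₁(K)`**: every completely positive matrix `F` over `K` is positive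
semidefinite, satisfies `tr(F M̂) ≥ 0`, has `P̂ F P̂ᵀ` entrywise nonnegative, and every row
of `P̂ F R̂ᵀ` belongs to `SOC(S_r)`. -/
theorem cp_subset_OA1
    (S Sp sr : ℕ) (Phat : Matrix (Fin Sp) (Fin (S + 1)) ℝ)
    (Rhat : Matrix (Fin (sr + 1)) (Fin (S + 1)) ℝ)
    (F : Matrix (Fin (S + 1)) (Fin (S + 1)) ℝ)
    (hF : IsCompletelyPositive (coneK S Sp sr Phat Rhat) F) :
    F.PosSemidef ∧ 0 ≤ (F * Mhat S sr Rhat).trace ∧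
      (∀ i j, 0 ≤ (Phat * F * Phatᵀ) i j) ∧
      (∀ i, (Phat * F * Rhatᵀ) i ∈ SOC sr) := by
  obtain ⟨m, x, hx, rfl⟩ := hF
  refine ⟨?_, ?_, ?_, ?_⟩
  · refine Matrix.posSemidef_sum _ fun k _ => ?_
    simpa using Matrix.posSemidef_vecMulVec_self_star (x k)
  · rw [Matrix.sum_mul, Matrix.trace_sum]
    refine Finset.sum_nonneg fun k _ => ?_
    rw [Mhat, Matrix.mul_sub, Matrix.trace_sub, Matrix.mul_sum, Matrix.trace_sum, trace_aux]
    simp only [trace_aux]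
    have h : Real.sqrt (∑ i : Fin sr, ((Rhat *ᵥ x k) i.castSucc) ^ 2)
      ≤ (Rhat *ᵥ x k) (Fin.last sr) := (hx k).2.2
    exact sub_nonneg.2 (Real.sqrt_le_left (Real.sqrt_nonneg _ |>.trans h) |>.1 h)
  · intro i j
    rw [sandwich_apply]
    exact Finset.sum_nonneg fun k _ => mul_nonneg ((hx k).2.1 i) ((hx k).2.1 j)
  · intro i
    have h := SOC_sum_smul sr m (fun k => (Phat *ᵥ x k) i) (fun k => (hx k).2.1 i)
      (fun k => Rhat *ᵥ x k) (fun k => (hx k).2.2)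
    convert h using 1
    ext j
    exact sandwich_apply _ _ _ _ _
end

section
/- Let Ξ ⊆ ℝ^d be a Borel set partitioned into pairwise disjoint Borel sets Ξ_1, …, Ξ_K with union Ξ, let f : Ξ → ℝ be bounded and measurable, let Δ be a nonempty subset of the probability simplex { p ∈ ℝ^K : p ≥ 0, Σ_k p_k = 1 }, and for each k let 𝒫_k be a nonempty set of Borel probability measures on Ξ supported on Ξ_k. Define the mixture ambiguity set 𝒫 = { Σ_{k=1}^K p_k P_k : p ∈ Δ, P_k ∈ 𝒫_k for all k }. Then sup_{P ∈ 𝒫} ∫_Ξ f dP = sup_{p ∈ Δ} Σ_{k=1}^K p_k ( sup_{P_k ∈ 𝒫_k} ∫_Ξ f dP_k ). -/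
open MeasureTheory

/-- **Decomposition of the worst-case expectation over a mixture ambiguity set.**
Let `Ξ ⊆ ℝ^d` be partitioned into pairwise disjoint Borel sets `Ξ_1, …, Ξ_K`, let `f` be
bounded and measurable, let `Δ` be a nonempty subset of the probability simplex, and let
each `𝓟_k` be a nonempty set of Borel probability measures supported on `Ξ_k`. Then for the
mixture ambiguity set `𝓟 = { Σ_k p_k P_k : p ∈ Δ, P_k ∈ 𝓟_k }`,
`sup_{P ∈ 𝓟} ∫ f dP = sup_{p ∈ Δ} Σ_k p_k ( sup_{P_k ∈ 𝓟_k} ∫ f dP_k )`. -/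
theorem mixture_ambiguity_sup_decomposition
    (d K : ℕ) (Ξ : Set (Fin d → ℝ)) (Ξk : Fin K → Set (Fin d → ℝ))
    (hΞmeas : ∀ k, MeasurableSet (Ξk k))
    (hdisj : Pairwise (Function.onFun Disjoint Ξk))
    (hunion : (⋃ k, Ξk k) = Ξ)
    (f : (Fin d → ℝ) → ℝ) (hfmeas : Measurable f)
    (hfbdd : ∃ M : ℝ, ∀ x ∈ Ξ, |f x| ≤ M)
    (Δ : Set (Fin K → ℝ)) (hΔne : Δ.Nonempty)
    (hΔ : ∀ p ∈ Δ, (∀ k, 0 ≤ p k) ∧ ∑ k, p k = 1)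
    (𝓟k : Fin K → Set (Measure (Fin d → ℝ))) (h𝓟ne : ∀ k, (𝓟k k).Nonempty)
    (h𝓟 : ∀ k, ∀ P ∈ 𝓟k k, IsProbabilityMeasure P ∧ P (Ξk k) = 1) :
    sSup ((fun P : Measure (Fin d → ℝ) => ∫ x, f x ∂P) ''
        {P | ∃ p ∈ Δ, ∃ Pk : Fin K → Measure (Fin d → ℝ),
            (∀ k, Pk k ∈ 𝓟k k) ∧ P = ∑ k, ENNReal.ofReal (p k) • Pk k})
      = sSup ((fun p : Fin K → ℝ =>
          ∑ k, p k * sSup ((fun Pm : Measure (Fin d → ℝ) => ∫ x, f x ∂Pm) '' 𝓟k k))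
            '' Δ) := by
  obtain ⟨M, hM⟩ := hfbdd
  have hae : ∀ k, ∀ P ∈ 𝓟k k, ∀ᵐ x ∂P, ‖f x‖ ≤ M := by
    intro k P hP
    obtain ⟨hp, h1⟩ := h𝓟 k P hP
    have h2 : ∀ᵐ x ∂P, x ∈ Ξk k := (prob_compl_eq_zero_iff (hΞmeas k)).2 h1
    filter_upwards [h2] with x hx
    exact hM x (hunion ▸ Set.mem_iUnion.2 ⟨k, hx⟩)
  have hint : ∀ k, ∀ P ∈ 𝓟k k, Integrable f P := by
    intro k P hP
    have := (h𝓟 k P hP).1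
    exact Integrable.of_bound hfmeas.aestronglyMeasurable M (hae k P hP)
  have hle : ∀ k, ∀ P ∈ 𝓟k k, ∫ x, f x ∂P ≤ M := by
    intro k P hP
    have := (h𝓟 k P hP).1
    have h := norm_integral_le_of_norm_le_const (hae k P hP)
    simp only [probReal_univ, mul_one] at h
    exact (le_abs_self _).trans h
  have hmix : ∀ p ∈ Δ, ∀ Pk : Fin K → Measure (Fin d → ℝ), (∀ k, Pk k ∈ 𝓟k k) →
      ∫ x, f x ∂(∑ k, ENNReal.ofReal (p k) • Pk k) = ∑ k, p k * ∫ x, f x ∂(Pk k) := by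
    intro p hp Pk hPk
    rw [integral_finsetSum_measure]
    · refine Finset.sum_congr rfl fun k _ => ?_
      rw [integral_smul_measure, ENNReal.toReal_ofReal ((hΔ p hp).1 k), smul_eq_mul]
    · intro k _
      exact (hint k _ (hPk k)).smul_measure ENNReal.ofReal_ne_top
  have hbk : ∀ k, BddAbove ((fun Pm : Measure (Fin d → ℝ) => ∫ x, f x ∂Pm) '' 𝓟k k) := by
    intro k
    refine ⟨M, ?_⟩
    rintro _ ⟨P, hP, rfl⟩
    exact hle k P hP
  have hbR : BddAbove ((fun p : Fin K → ℝ =>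
      ∑ k, p k * sSup ((fun Pm : Measure (Fin d → ℝ) => ∫ x, f x ∂Pm) '' 𝓟k k)) '' Δ) := by
    refine ⟨M, ?_⟩
    rintro _ ⟨p, hp, rfl⟩
    calc _ ≤ ∑ k, p k * M := by
          refine Finset.sum_le_sum fun k _ => mul_le_mul_of_nonneg_left ?_ ((hΔ p hp).1 k)
          refine csSup_le ((h𝓟ne k).image _) ?_
          rintro _ ⟨P, hP, rfl⟩
          exact hle k P hP
      _ = M := by rw [← Finset.sum_mul, (hΔ p hp).2, one_mul]
  apply IsLUB.csSup_eq
  · constructor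
    · rintro _ ⟨_, ⟨p, hp, Pk, hPk, rfl⟩, rfl⟩
      refine le_trans ?_ (le_csSup hbR ⟨p, hp, rfl⟩)
      simp only [hmix p hp Pk hPk]
      exact Finset.sum_le_sum fun k _ => mul_le_mul_of_nonneg_left
        (le_csSup (hbk k) ⟨Pk k, hPk k, rfl⟩) ((hΔ p hp).1 k)
    · intro b hb
      refine csSup_le (hΔne.image _) ?_
      rintro _ ⟨p, hp, rfl⟩
      refine le_of_forall_pos_le_add fun ε hε => ?_
      have hex : ∀ k, ∃ P ∈ 𝓟k k,
          sSup ((fun Pm : Measure (Fin d → ℝ) => ∫ x, f x ∂Pm) '' 𝓟k k) - ε < ∫ x, f x ∂P := by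
        intro k
        obtain ⟨_, ⟨P, hP, rfl⟩, h⟩ := exists_lt_of_lt_csSup ((h𝓟ne k).image _)
          (sub_lt_self (sSup ((fun Pm : Measure (Fin d → ℝ) => ∫ x, f x ∂Pm) '' 𝓟k k)) hε)
        exact ⟨P, hP, h⟩
      choose Pk hPk hlt using hex
      have h1 : ∫ x, f x ∂(∑ k, ENNReal.ofReal (p k) • Pk k) ≤ b :=
        hb ⟨_, ⟨p, hp, Pk, hPk, rfl⟩, rfl⟩
      rw [hmix p hp Pk hPk] at h1
      calc _ ≤ ∑ k, p k * (∫ x, f x ∂(Pk k) + ε) :=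
            Finset.sum_le_sum fun k _ => mul_le_mul_of_nonneg_left
              (by linarith [hlt k]) ((hΔ p hp).1 k)
        _ = ∑ k, p k * ∫ x, f x ∂(Pk k) + ε := by
            simp only [mul_add, Finset.sum_add_distrib]
            rw [← Finset.sum_mul, (hΔ p hp).2, one_mul]
        _ ≤ b + ε := by linarith
  · obtain ⟨p, hp⟩ := hΔne
    choose Pk hPk using h𝓟ne
    exact ⟨_, _, ⟨p, hp, Pk, hPk, rfl⟩, rfl⟩
end
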